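/- Let l, n, m, k be positive integers, and define the bilinear pairing B : ℤ² × ℤ² → ℤ by B(u, v) = l·u₁·v₁ - u₂·v₁. Then there do not exist vectors u, v ∈ ℤ² satisfying all of the following: |u₁| ≤ n, |u₂| ≤ m, v₁ ≥ k, v₁·v₂ ≤ 0, B(u, u) = l·n² + n·m, B(v, v) = l·k², and (B(u, v) = n·k·l or B(u, v) = -n·k·l). -/

import Mathlib

theorem no_compatible_difference_classes (l n m k : ℤ)
    (hl : 0 < l) (hn : 0 < n) (hm : 0 < m) (hk : 0 < k)
    (B : (Fin 2 → ℤ) → (Fin 2 → ℤ) → ℤ)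
    (hB : ∀ u v : Fin 2 → ℤ, B u v = l * u 0 * v 0 - u 1 * v 0) :
    ¬ ∃ u v : Fin 2 → ℤ,
        |u 0| ≤ n ∧ |u 1| ≤ m ∧ k ≤ v 0 ∧ v 0 * v 1 ≤ 0 ∧
        B u u = l * n ^ 2 + n * m ∧ B v v = l * k ^ 2 ∧
        (B u v = n * k * l ∨ B u v = -(n * k * l)) := by
  rintro ⟨u, v, hu0, -, hkv, hv, huu, hvv, huv⟩
  rw [hB] at huu hvv
  rw [hB u v] at huv
  have hvk : v 0 = k := by
    have hsq : v 0 ^ 2 ≤ k ^ 2 := le_of_mul_le_mul_left (by linarith) hl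
    exact le_antisymm ((sq_le_sq₀ (hk.le.trans hkv) hk.le).mp hsq) hkv
  rw [hvk] at huv
  obtain ⟨hlo, hhi⟩ := abs_le.mp hu0
  have hnl : 0 < n * l := mul_pos hn hl
  have hnm : 0 < n * m := mul_pos hn hm
  rcases huv with huv | huv
  · have hw : l * u 0 - u 1 = n * l := mul_right_cancel₀ hk.ne' (by linarith)
    have huw : u 0 * (n * l) = l * n ^ 2 + n * m := by rw [← hw, ← huu]; ring
    linarith [mul_le_mul_of_nonneg_right hhi hnl.le]
  · have hw : l * u 0 - u 1 = -(n * l) := mul_right_cancel₀ hk.ne' (by linarith)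
    have huw : u 0 * -(n * l) = l * n ^ 2 + n * m := by rw [← hw, ← huu]; ring
    linarith [mul_le_mul_of_nonneg_right hlo hnl.le]
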